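/- Let α ∈ F_q with α ≠ 0, let μ = [μ_1 ≥ … ≥ μ_r] be a partition of n ≥ 1, and let a ∈ M_n(F_q) have unique eigenvalue α and filtration type μ. Let a′ ∈ M_{n−1}(F_q), a″ ∈ M_{n−2}(F_q), a‴ ∈ M_{n−2}(F_q) be matrices with unique eigenvalue α and filtration types μ′, μ″, μ‴ respectively (with zero parts dropped), whenever these partitions are defined; the matrix Kloosterman sum of the empty (0×0) matrix is 1. Then K(a) = q^{n−1}·Kl(α)·K(a′) − q^{2n+μ_r−3}·K(a″) + (q^{μ_r−1} − 1)·q^{2n−2}·K(a‴), where a summand is omitted whenever the corresponding partition (μ″ when r = 1, μ‴ when μ_r = 1) is undefined. -/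

import Mathlib

open Matrix Module

/-- The matrix Kloosterman sum `K(b) = Σ_{x ∈ GL_m(F)} ψ(tr(b·x + x⁻¹))`. -/
noncomputable def matKloosterman (F : Type) [Field F] [Fintype F] [DecidableEq F]
    (ψ : F → ℂ) {m : ℕ} (b : Matrix (Fin m) (Fin m) F) : ℂ :=
  ∑ x : GL (Fin m) F,
    ψ (Matrix.trace (b * (x : Matrix (Fin m) (Fin m) F)
      + ((x⁻¹ : GL (Fin m) F) : Matrix (Fin m) (Fin m) F)))

/-- `kdim b α j = dim ker((b − α·id)^j)`. -/
noncomputable def kdim (F : Type) [Field F] {m : ℕ}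
    (b : Matrix (Fin m) (Fin m) F) (α : F) (j : ℕ) : ℕ :=
  finrank F (LinearMap.ker (Matrix.mulVecLin
    ((b - α • (1 : Matrix (Fin m) (Fin m) F)) ^ j)))



section MKCore

set_option linter.unusedSectionVars false

attribute [local instance] Fintype.ofFinite

open Classical

theorem mk_finite_end {F : Type} [Field F] {V W : Type} [AddCommGroup V] [Module F V] [Finite V]
    [AddCommGroup W] [Module F W] [Finite W] : Finite (V →ₗ[F] W) :=
  DFunLike.finite _

theorem mk_finite_equiv {F : Type} [Field F] {V : Type} [AddCommGroup V] [Module F V] [Finite V] :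
    Finite (V ≃ₗ[F] V) :=
  DFunLike.finite _

attribute [local instance] mk_finite_end mk_finite_equiv

variable {F : Type} [Field F] [Finite F]
variable {V : Type} [AddCommGroup V] [Module F V] [Finite V]
variable {P : Type} [AddCommGroup P] [Module F P] [Finite P]
variable {Q : Type} [AddCommGroup Q] [Module F Q] [Finite Q]

/-- summand of the Kloosterman sum -/
noncomputable def mkE (ψ : AddChar F ℂ) (f : V →ₗ[F] V) (z : V ≃ₗ[F] V) : ℂ :=
  ψ (LinearMap.trace F V (f ∘ₗ (z : V →ₗ[F] V)) + LinearMap.trace F V (z.symm : V →ₗ[F] V))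

/-- Kloosterman sum of an endomorphism -/
noncomputable def mkK (ψ : AddChar F ℂ) (f : V →ₗ[F] V) : ℂ := ∑ z : V ≃ₗ[F] V, mkE ψ f z

theorem mk_split (i : P →ₗ[F] V) (hi : Function.Injective i) (π : V →ₗ[F] Q)
    (hπ : Function.Surjective π) (hk : LinearMap.ker π = LinearMap.range i) :
    ∃ φ : V ≃ₗ[F] Q × P, (∀ v, (φ v).1 = π v) ∧ (∀ p, φ (i p) = (0, p)) := by
  obtain ⟨ρ, hρ⟩ := LinearMap.exists_leftInverse_of_injective i (LinearMap.ker_eq_bot.2 hi)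
  have hρ' : ∀ p, ρ (i p) = p := fun p => by simpa using congrArg (fun h => h p) hρ
  have hπi : ∀ p, π (i p) = 0 := fun p => by
    have : i p ∈ LinearMap.ker π := by rw [hk]; exact ⟨p, rfl⟩
    simpa using this
  refine ⟨LinearEquiv.ofBijective (π.prod ρ) ⟨?_, ?_⟩, fun v => rfl, fun p => ?_⟩
  · rw [← LinearMap.ker_eq_bot, eq_bot_iff]
    intro v hv
    have h1 : π v = 0 := congrArg Prod.fst hv
    have h2 : ρ v = 0 := congrArg Prod.snd hv
    have : v ∈ LinearMap.range i := by rw [← hk]; simpa using h1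
    obtain ⟨p, rfl⟩ := this
    rw [hρ'] at h2
    simp [h2]
  · rintro ⟨x, p⟩
    obtain ⟨v, rfl⟩ := hπ x
    refine ⟨v + i (p - ρ v), ?_⟩
    ext <;> simp [hπi, hρ']
  · exact Prod.ext (hπi p) (hρ' p)

theorem mk_trace (i : P →ₗ[F] V) (hi : Function.Injective i) (π : V →ₗ[F] Q)
    (hπ : Function.Surjective π) (hk : LinearMap.ker π = LinearMap.range i)
    (h : V →ₗ[F] V) (h0 : P →ₗ[F] P) (h2 : Q →ₗ[F] Q) (e0 : h ∘ₗ i = i ∘ₗ h0)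
    (e2 : π ∘ₗ h = h2 ∘ₗ π) :
    LinearMap.trace F V h = LinearMap.trace F P h0 + LinearMap.trace F Q h2 := by
  obtain ⟨φ, h1φ, h2φ⟩ := mk_split i hi π hπ hk
  have e0' : ∀ p, h (i p) = i (h0 p) := fun p => by simpa using congrArg (fun h => h p) e0
  have e2' : ∀ p, π (h p) = h2 (π p) := fun p => by simpa using congrArg (fun h => h p) e2
  have hs : ∀ p, φ.symm (0, p) = i p := fun p => by rw [← h2φ, φ.symm_apply_apply]
  have hp : ∀ x, π (φ.symm x) = x.1 := fun x => by rw [← h1φ, φ.apply_symm_apply]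
  rw [← LinearMap.trace_conj' h φ]
  set c : Q →ₗ[F] P := LinearMap.snd F Q P ∘ₗ (φ.conj h) ∘ₗ LinearMap.inl F Q P
  have : φ.conj h = h2.prodMap h0 + (LinearMap.inr F Q P ∘ₗ c ∘ₗ LinearMap.fst F Q P) := by
    apply LinearMap.prod_ext
    · ext x
      · simp [LinearEquiv.conj_apply, h1φ, e2', hp]
      · simp [LinearEquiv.conj_apply, c]
    · ext x
      · simp [LinearEquiv.conj_apply, h2φ, e0', hs]
      · simp [LinearEquiv.conj_apply, h2φ, e0', hs]
  rw [this, map_add, LinearMap.trace_prodMap', ← LinearMap.comp_assoc, LinearMap.trace_comp_comm']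
  have : LinearMap.fst F Q P ∘ₗ LinearMap.inr F Q P ∘ₗ c = 0 := by
    ext; simp
  rw [this]; simp [add_comm]

theorem mk_stab (ψ : AddChar F ℂ) (f : V →ₗ[F] V)
    (i : P →ₗ[F] V) (hi : Function.Injective i) (π : V →ₗ[F] Q)
    (hπ : Function.Surjective π) (hk : LinearMap.ker π = LinearMap.range i)
    (a0 : P →ₗ[F] P) (g : Q →ₗ[F] Q) (hf : f ∘ₗ i = i ∘ₗ a0) (hg : π ∘ₗ f = g ∘ₗ π)
    (z0 : P ≃ₗ[F] P) :
    (∑ z : V ≃ₗ[F] V, if (∀ p, z (i p) = i (z0 p)) then mkE ψ f z else 0)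
      = (Nat.card F : ℂ) ^ (finrank F Q * finrank F P) * mkE ψ a0 z0 * mkK ψ g := by
  obtain ⟨φ, h1φ, h2φ⟩ := mk_split i hi π hπ hk
  have hs : ∀ p, φ.symm (0, p) = i p := fun p => by rw [← h2φ, φ.symm_apply_apply]
  have hp : ∀ x, π (φ.symm x) = x.1 := fun x => by rw [← h1φ, φ.apply_symm_apply]
  let Φ : (Q ≃ₗ[F] Q) × (Q →ₗ[F] P) → (V ≃ₗ[F] V) := fun x =>
    (φ.trans (x.1.skewProd z0 x.2)).trans φ.symm
  have hΦ : ∀ x v, φ (Φ x v) = (x.1 (φ v).1, z0 (φ v).2 + x.2 (φ v).1) := by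
    intro x v; simp [Φ]
  have hΦi : ∀ x p, Φ x (i p) = i (z0 p) := by
    intro x p
    apply φ.injective
    rw [hΦ, h2φ, h2φ]; simp
  have hΦπ : ∀ x v, π (Φ x v) = x.1 (π v) := by
    intro x v
    rw [← h1φ, hΦ, h1φ]
  have hinj : Function.Injective Φ := by
    intro x y hxy
    have key : ∀ v, (x.1 (φ v).1, z0 (φ v).2 + x.2 (φ v).1)
        = (y.1 (φ v).1, z0 (φ v).2 + y.2 (φ v).1) := fun v => by rw [← hΦ, ← hΦ, hxy]
    have key2 : ∀ q : Q, x.1 q = y.1 q ∧ x.2 q = y.2 q := fun q => by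
      have := key (φ.symm (q, 0))
      simpa using this
    refine Prod.ext ?_ ?_
    · ext q; exact (key2 q).1
    · ext q; exact (key2 q).2
  have hval : ∀ x, mkE ψ f (Φ x) = mkE ψ a0 z0 * mkE ψ g x.1 := by
    intro x
    have hf' : ∀ p, f (i p) = i (a0 p) := fun p => by simpa using congrArg (fun h => h p) hf
    have hg' : ∀ p, π (f p) = g (π p) := fun p => by simpa using congrArg (fun h => h p) hg
    have t1 := mk_trace i hi π hπ hk (f ∘ₗ (Φ x : V →ₗ[F] V)) (a0 ∘ₗ (z0 : P →ₗ[F] P))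
      (g ∘ₗ (x.1 : Q →ₗ[F] Q)) (by ext p; simp [hΦi, hf']) (by ext p; simp [hΦπ, hg'])
    have t2 := mk_trace i hi π hπ hk ((Φ x).symm : V →ₗ[F] V) (z0.symm : P →ₗ[F] P)
      (x.1.symm : Q →ₗ[F] Q)
      (by
        ext p
        apply (Φ x).injective
        simp [hΦi])
      (by
        ext p
        apply x.1.injective
        simp [← hΦπ])
    unfold mkE
    rw [t1, t2, ← AddChar.map_add_eq_mul]
    congr 1; ring
  have hsum := Fintype.sum_of_injective Φ hinj
    (fun x => mkE ψ a0 z0 * mkE ψ g x.1)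
    (fun z : V ≃ₗ[F] V => if (∀ p, z (i p) = i (z0 p)) then mkE ψ f z else 0)
    (by
      intro z hz
      rw [if_neg]
      intro hzi
      apply hz
      let A : Q →ₗ[F] V := (φ.symm : Q × P →ₗ[F] V) ∘ₗ LinearMap.inl F Q P
      let y2 : Q →ₗ[F] Q := π ∘ₗ (z : V →ₗ[F] V) ∘ₗ A
      have hy2 : Function.Injective y2 := by
        rw [← LinearMap.ker_eq_bot, eq_bot_iff]
        intro q hq
        have : z (A q) ∈ LinearMap.range i := by rw [← hk]; exact hq
        obtain ⟨p, hp'⟩ := this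
        have h3 : z (A q) = z (i (z0.symm p)) := by rw [hzi]; simp [hp']
        have h4 := congrArg φ (z.injective h3)
        rw [h2φ] at h4
        simpa [A] using congrArg Prod.fst h4
      refine ⟨(LinearEquiv.ofInjectiveEndo y2 hy2,
        LinearMap.snd F Q P ∘ₗ (φ : V →ₗ[F] Q × P) ∘ₗ (z : V →ₗ[F] V) ∘ₗ A), ?_⟩
      ext v
      apply φ.injective
      rw [hΦ]
      obtain ⟨⟨q, p⟩, rfl⟩ := φ.symm.surjective v
      have e1 : φ.symm (q, p) = A q + i p := by
        rw [← hs]; simp [A, ← map_add]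
      have e2 : φ (z (φ.symm (q, p))) = φ (z (A q)) + (0, z0 p) := by
        rw [e1, map_add, map_add, hzi, h2φ]
      rw [e2]
      ext
      · simp [y2, h1φ]
      · simp [add_comm])
    (by
      intro x
      rw [if_pos (hΦi x), hval])
  rw [← hsum, Fintype.sum_prod_type]
  simp only [Finset.sum_const, Finset.card_univ, nsmul_eq_mul, ← Finset.mul_sum]
  rw [Module.card_eq_pow_finrank (K := F), Module.finrank_linearMap, mkK, mul_assoc,
    Fintype.card_eq_nat_card]
  push_cast
  rfl

/-- functionals killing `e` -/
noncomputable abbrev mkU (F : Type) [Field F] {V : Type} [AddCommGroup V] [Module F V] (e : V) :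
    Submodule F (Dual F V) := (Submodule.span F {e}).dualAnnihilator

theorem mkU_apply (e : V) (l : mkU F e) : l.1 e = 0 :=
  (Submodule.mem_dualAnnihilator _).1 l.2 e (Submodule.mem_span_singleton_self e)

theorem mk_orth (ψ : AddChar F ℂ) (hψ : ψ ≠ 1) (e m : V) :
    ∑ l : mkU F e, ψ (l.1 m)
      = if m ∈ Submodule.span F {e} then (Fintype.card (mkU F e) : ℂ) else 0 := by
  split_ifs with hm
  · have : ∀ l : mkU F e, ψ (l.1 m) = 1 := fun l => by
      rw [(Submodule.mem_dualAnnihilator _).1 l.2 m hm, AddChar.map_zero_eq_one]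
    simp [this]
  · let χ : AddChar (mkU F e) ℂ :=
      ψ.compAddMonoidHom ((Dual.eval F V m ∘ₗ (mkU F e).subtype).toAddMonoidHom)
    have hχ : ∀ l, χ l = ψ (l.1 m) := fun l => rfl
    simp only [← hχ]
    apply AddChar.sum_eq_zero_of_ne_one
    intro h1
    apply hψ
    obtain ⟨l, hl1, hl2⟩ := Submodule.exists_dual_map_eq_bot_of_notMem hm inferInstance
    have hl : l ∈ mkU F e := by
      rw [Submodule.mem_dualAnnihilator]
      intro w hw
      have : l w ∈ Submodule.map l (Submodule.span F {e}) := ⟨w, hw, rfl⟩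
      rw [hl2] at this
      exact (Submodule.mem_bot F).1 this
    ext c
    have := congrArg (fun χ => χ ((c / l m) • (⟨l, hl⟩ : mkU F e))) h1
    simp only [hχ] at this
    simpa [hl1] using this

theorem mk_avg (ψ : AddChar F ℂ) (hψ : ψ ≠ 1) (e : V) {X : Type} [Fintype X] (S : X → Prop)
    [DecidablePred S] (R : X → Prop) [DecidablePred R]
    (E : X → ℂ) (m : X → V) (T : mkU F e → X ≃ X) (hS : ∀ l x, S (T l x) ↔ S x)
    (hE : ∀ l x, E (T l x) = E x * ψ (l.1 (m x)))
    (hR : ∀ x, R x ↔ S x ∧ m x ∈ Submodule.span F {e}) :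
    (∑ x, if S x then E x else 0)
      = ∑ x, if R x then E x else 0 := by
  have hc : (Fintype.card (mkU F e) : ℂ) ≠ 0 := Nat.cast_ne_zero.2 Fintype.card_ne_zero
  apply mul_left_cancel₀ hc
  have h1 : ∀ l : mkU F e, (∑ x, if S x then E x else 0)
      = ∑ x, if S x then E x * ψ (l.1 (m x)) else 0 := by
    intro l
    rw [← Equiv.sum_comp (T l)]
    refine Finset.sum_congr rfl fun x _ => ?_
    rw [hE]; simp only [hS]
  calc (Fintype.card (mkU F e) : ℂ) * (∑ x, if S x then E x else 0)
      = ∑ l : mkU F e, ∑ x, if S x then E x else 0 := by simp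
    _ = ∑ l : mkU F e, ∑ x, if S x then E x * ψ (l.1 (m x)) else 0 :=
        Finset.sum_congr rfl fun l _ => h1 l
    _ = ∑ x, ∑ l : mkU F e, if S x then E x * ψ (l.1 (m x)) else 0 := Finset.sum_comm
    _ = _ := by
      rw [Finset.mul_sum]
      refine Finset.sum_congr rfl fun x _ => ?_
      simp only [hR]
      by_cases hx : S x
      · simp only [hx, if_true, true_and, ← Finset.mul_sum, mk_orth ψ hψ]
        split_ifs <;> ring
      · simp [hx]

/-- the transvection attached to a functional killing `e` -/
noncomputable def mkT (e : V) (l : mkU F e) : V ≃ₗ[F] V :=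
  LinearEquiv.ofLinearMap (LinearMap.id + l.1.smulRight e) (LinearMap.id - l.1.smulRight e)
    (by ext v; simp [mkU_apply]) (by ext v; simp [mkU_apply])

theorem mkT_apply (e : V) (l : mkU F e) (v : V) : mkT e l v = v + l.1 v • e := rfl

theorem mkT_symm_apply (e : V) (l : mkU F e) (v : V) : (mkT e l).symm v = v - l.1 v • e := rfl

theorem mkT_coe (e : V) (l : mkU F e) :
    (mkT e l : V →ₗ[F] V) = LinearMap.id + l.1.smulRight e := rfl

theorem mkT_symm_coe (e : V) (l : mkU F e) :
    ((mkT e l).symm : V →ₗ[F] V) = LinearMap.id - l.1.smulRight e := rfl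

theorem mkT_e (e : V) (l : mkU F e) : mkT e l e = e := by simp [mkT_apply, mkU_apply]

theorem mkT_symm_e (e : V) (l : mkU F e) : (mkT e l).symm e = e := by
  simp [mkT_symm_apply, mkU_apply]

theorem mkE_right (ψ : AddChar F ℂ) (f : V →ₗ[F] V) (e : V) (l : mkU F e) (z : V ≃ₗ[F] V) :
    mkE ψ f ((mkT e l).trans z) = mkE ψ f z * ψ (l.1 (f (z e) - z.symm e)) := by
  unfold mkE
  rw [← AddChar.map_add_eq_mul]
  congr 1
  have h1 : f ∘ₗ (((mkT e l).trans z : V ≃ₗ[F] V) : V →ₗ[F] V)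
      = f ∘ₗ (z : V →ₗ[F] V) + l.1.smulRight (f (z e)) := by
    ext v; simp [mkT_apply]
  have h2 : ((((mkT e l).trans z).symm : V ≃ₗ[F] V) : V →ₗ[F] V)
      = (z.symm : V →ₗ[F] V) - (l.1 ∘ₗ (z.symm : V →ₗ[F] V)).smulRight e := by
    ext v; simp [mkT_symm_apply]
  rw [h1, h2, map_add, map_sub, LinearMap.trace_smulRight, LinearMap.trace_smulRight]
  simp; ring

theorem mkE_left (ψ : AddChar F ℂ) (f : V →ₗ[F] V) (e : V) (α : F) (he : f e = α • e)
    (l : mkU F e) (z : V ≃ₗ[F] V) :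
    mkE ψ f (z.trans (mkT e l)) = mkE ψ f z * ψ (l.1 (α • z e - z.symm e)) := by
  unfold mkE
  rw [← AddChar.map_add_eq_mul]
  congr 1
  have h1 : f ∘ₗ ((z.trans (mkT e l) : V ≃ₗ[F] V) : V →ₗ[F] V)
      = f ∘ₗ (z : V →ₗ[F] V) + (l.1 ∘ₗ (z : V →ₗ[F] V)).smulRight (α • e) := by
    ext v; simp [mkT_apply, he]
  have h2 : (((z.trans (mkT e l)).symm : V ≃ₗ[F] V) : V →ₗ[F] V)
      = (z.symm : V →ₗ[F] V) - l.1.smulRight (z.symm e) := by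
    ext v; simp [mkT_symm_apply]
  rw [h1, h2, map_add, map_sub, LinearMap.trace_smulRight, LinearMap.trace_smulRight]
  simp; ring

theorem mk_offP (ψ : AddChar F ℂ) (hψ : ψ ≠ 1) (f : V →ₗ[F] V) (e : V) (α : F)
    (he : f e = α • e) :
    (∑ z : V ≃ₗ[F] V, if z e ∉ Submodule.span F {e} then mkE ψ f z else 0)
      = ∑ z : V ≃ₗ[F] V, if ((z e ∉ Submodule.span F {e}
          ∧ f (z e) - z.symm e ∈ Submodule.span F {e})
          ∧ α • z e - z.symm e ∈ Submodule.span F {e}) then mkE ψ f z else 0 := by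
  have hmem : ∀ c : F, c • e ∈ Submodule.span F {e} := fun c =>
    Submodule.smul_mem _ _ (Submodule.mem_span_singleton_self e)
  rw [mk_avg ψ hψ e (fun z : V ≃ₗ[F] V => z e ∉ Submodule.span F {e}) (fun z : V ≃ₗ[F] V => z e ∉ Submodule.span F {e} ∧
      f (z e) - z.symm e ∈ Submodule.span F {e}) (mkE ψ f)
    (fun z => f (z e) - z.symm e)
    (fun l => ⟨fun z => (mkT e l).trans z, fun z => (mkT e l).symm.trans z,
      fun z => by ext; simp, fun z => by ext; simp⟩)
    (fun l z => by simp [mkT_e]) (fun l z => mkE_right ψ f e l z) (fun _ => Iff.rfl)]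
  rw [mk_avg ψ hψ e (fun z : V ≃ₗ[F] V => z e ∉ Submodule.span F {e} ∧
      f (z e) - z.symm e ∈ Submodule.span F {e})
    (fun z : V ≃ₗ[F] V => (z e ∉ Submodule.span F {e} ∧ f (z e) - z.symm e ∈ Submodule.span F {e})
      ∧ α • z e - z.symm e ∈ Submodule.span F {e}) (mkE ψ f)
    (fun z => α • z e - z.symm e)
    (fun l => ⟨fun z => z.trans (mkT e l), fun z => z.trans (mkT e l).symm,
      fun z => by ext; simp, fun z => by ext; simp⟩)
    ?_ (fun l z => mkE_left ψ f e α he l z) (fun _ => Iff.rfl)]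
  intro l z
  simp only [Equiv.coe_fn_mk, LinearEquiv.trans_apply, LinearEquiv.symm_trans_apply, mkT_symm_e]
  rw [mkT_apply, map_add, map_smul, he, smul_smul]
  rw [Submodule.add_mem_iff_left _ (hmem _), add_sub_right_comm,
    Submodule.add_mem_iff_left _ (hmem _)]

/-- Kloosterman sum of the induced map on a quotient -/
noncomputable def mkKq (ψ : AddChar F ℂ) (f : V →ₗ[F] V) (W : Submodule F V) : ℂ :=
  if h : W ≤ W.comap f then mkK ψ (W.mapQ W f h) else 0

theorem mk_stab_sub (ψ : AddChar F ℂ) (f : V →ₗ[F] V)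
    (i : P →ₗ[F] V) (hi : Function.Injective i) (W : Submodule F V) (hW : LinearMap.range i = W)
    (a0 : P →ₗ[F] P) (hf : ∀ p, f (i p) = i (a0 p)) (z0 : P ≃ₗ[F] P) :
    (∑ z : V ≃ₗ[F] V, if (∀ p, z (i p) = i (z0 p)) then mkE ψ f z else 0)
      = (Nat.card F : ℂ) ^ ((finrank F V - finrank F P) * finrank F P) * mkE ψ a0 z0
        * mkKq ψ f W := by
  subst hW
  have h : LinearMap.range i ≤ (LinearMap.range i).comap f := by
    rintro _ ⟨p, rfl⟩
    exact ⟨a0 p, (hf p).symm⟩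
  rw [mkKq, dif_pos h]
  rw [mk_stab ψ f i hi (LinearMap.range i).mkQ (Submodule.mkQ_surjective _) (Submodule.ker_mkQ _)
    a0 ((LinearMap.range i).mapQ (LinearMap.range i) f h) (LinearMap.ext hf)
    (Submodule.mapQ_mkQ _ _ _).symm z0, Submodule.finrank_quotient, LinearMap.finrank_range_of_inj hi]

theorem mk_trace_one (c : F) (g : F →ₗ[F] F) (hg : ∀ x, g x = c * x) : LinearMap.trace F F g = c := by
  have : g = c • LinearMap.id := by ext; simp [hg]
  rw [this]; simp

theorem mk_onP (ψ : AddChar F ℂ) (f : V →ₗ[F] V) (e : V) (he0 : e ≠ 0) (α : F)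
    (he : f e = α • e) :
    (∑ z : V ≃ₗ[F] V, if z e ∈ Submodule.span F {e} then mkE ψ f z else 0)
      = (Nat.card F : ℂ) ^ (finrank F V - 1) * (∑ t : Fˣ, ψ (α * (t : F) + ((t⁻¹ : Fˣ) : F)))
        * mkKq ψ f (Submodule.span F {e}) := by
  have h1 : ∀ z : V ≃ₗ[F] V, (if z e ∈ Submodule.span F {e} then mkE ψ f z else 0)
      = ∑ t : Fˣ, if z e = (t : F) • e then mkE ψ f z else 0 := by
    intro z
    split_ifs with hz
    · obtain ⟨c, hc⟩ := Submodule.mem_span_singleton.1 hz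
      have hc0 : c ≠ 0 := by
        rintro rfl
        rw [zero_smul] at hc
        exact he0 (by simpa using hc.symm)
      rw [Finset.sum_eq_single (Units.mk0 c hc0)]
      · simp [hc]
      · intro t _ ht
        rw [if_neg]
        intro h
        apply ht
        rw [← hc] at h
        ext
        exact (smul_left_injective F he0 h).symm
      · simp
    · symm
      apply Finset.sum_eq_zero
      intro t _
      rw [if_neg]
      intro h
      exact hz (Submodule.mem_span_singleton.2 ⟨t, h.symm⟩)
  simp only [h1]
  rw [Finset.sum_comm, Finset.mul_sum, Finset.sum_mul]
  refine Finset.sum_congr rfl fun t _ => ?_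
  have := mk_stab_sub ψ f (LinearMap.toSpanSingleton F V e)
    (smul_left_injective F he0) (Submodule.span F {e})
    (LinearMap.range_toSpanSingleton e) (α • LinearMap.id)
    (fun p => by simp [he, smul_smul, mul_comm]) (LinearEquiv.smulOfUnit t)
  have hE : mkE ψ (α • LinearMap.id) (LinearEquiv.smulOfUnit t : F ≃ₗ[F] F)
      = ψ (α * (t : F) + ((t⁻¹ : Fˣ) : F)) := by
    unfold mkE
    rw [mk_trace_one (α * t), mk_trace_one ((t⁻¹ : Fˣ) : F)]
    · intro x; rfl
    · intro x
      change α * (t * x) = _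
      ring
  rw [hE, finrank_self, mul_one] at this
  rw [← this]
  refine Finset.sum_congr rfl fun z _ => ?_
  refine if_congr ?_ rfl rfl
  constructor
  · intro h p
    change z (p • e) = (t * p) • e
    rw [map_smul, h, smul_smul, mul_comm]
  · intro h
    have := h 1
    change z ((1 : F) • e) = ((t : F) * 1) • e at this
    simpa using this

/-- the two dimensional piece -/
noncomputable def mkZ0 (α κ : F) (hα : α ≠ 0) : (F × F) ≃ₗ[F] (F × F) :=
  { toFun := fun p => (α⁻¹ * p.2, p.1 - κ * (α⁻¹ * p.2))
    invFun := fun p => (p.2 + κ * p.1, α * p.1)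
    map_add' := fun p q => by ext <;> simp <;> ring
    map_smul' := fun c p => by ext <;> simp <;> ring
    left_inv := fun p => by ext <;> simp [hα]
    right_inv := fun p => by ext <;> simp [hα] }

theorem mk_trace_two (g : F × F →ₗ[F] F × F) :
    LinearMap.trace F (F × F) g = (g (1, 0)).1 + (g (0, 1)).2 := by
  rw [LinearMap.trace_eq_matrix_trace F (Basis.finTwoProd F), Matrix.trace_fin_two]
  simp [LinearMap.toMatrix_apply]

theorem mk_pair (e w : V) (he0 : e ≠ 0) (hw : w ∉ Submodule.span F {e}) (s t : F)
    (h : s • e + t • w = 0) : s = 0 ∧ t = 0 := by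
  have ht : t = 0 := by
    by_contra ht
    apply hw
    rw [Submodule.mem_span_singleton]
    refine ⟨-(t⁻¹ * s), ?_⟩
    have h2 : t • w = -(s • e) := by rw [eq_neg_iff_add_eq_zero, add_comm]; exact h
    have h3 : w = t⁻¹ • (t • w) := by rw [smul_smul, inv_mul_cancel₀ ht, one_smul]
    rw [h3, h2, smul_neg, smul_smul, neg_smul]
  subst ht
  simpa [he0] using h

theorem mk_two (ψ : AddChar F ℂ) (f : V →ₗ[F] V) (e w : V) (he0 : e ≠ 0) (α γ κ : F)
    (hα : α ≠ 0) (he : f e = α • e) (hw : w ∉ Submodule.span F {e})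
    (hfw : f w = α • w + γ • e) :
    (∑ z : V ≃ₗ[F] V, if (z e = w ∧ z.symm e = α • w + κ • e) then mkE ψ f z else 0)
      = (Nat.card F : ℂ) ^ ((finrank F V - 2) * 2) * ψ γ
        * mkKq ψ f (Submodule.span F {e, w}) := by
  let i : F × F →ₗ[F] V :=
    (LinearMap.toSpanSingleton F V e).coprod (LinearMap.toSpanSingleton F V w)
  have hi : ∀ p, i p = p.1 • e + p.2 • w := fun p => rfl
  have hinj : Function.Injective i := by
    rw [← LinearMap.ker_eq_bot, eq_bot_iff]
    rintro ⟨s, t⟩ hp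
    obtain ⟨rfl, rfl⟩ := mk_pair e w he0 hw s t hp
    simp
  have hr : LinearMap.range i = Submodule.span F {e, w} := by
    rw [LinearMap.range_coprod, LinearMap.range_toSpanSingleton,
      LinearMap.range_toSpanSingleton, Submodule.span_insert]
  let a0 : F × F →ₗ[F] F × F :=
    { toFun := fun p => (α * p.1 + γ * p.2, α * p.2)
      map_add' := fun p q => by ext <;> simp <;> ring
      map_smul' := fun c p => by ext <;> simp <;> ring }
  have := mk_stab_sub ψ f i hinj _ hr a0
    (fun p => by
      rw [hi, hi, map_add, map_smul, map_smul, he, hfw]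
      simp only [a0, LinearMap.coe_mk, AddHom.coe_mk]
      module) (mkZ0 α κ hα)
  have hE : mkE ψ a0 (mkZ0 α κ hα) = ψ γ := by
    unfold mkE
    rw [mk_trace_two, mk_trace_two]
    congr 1
    simp [a0, mkZ0]
    field_simp
    ring
  rw [hE, finrank_prod, finrank_self] at this
  rw [← this]
  refine Finset.sum_congr rfl fun z _ => ?_
  suffices hiff : (z e = w ∧ z.symm e = α • w + κ • e) ↔ ∀ p, z (i p) = i (mkZ0 α κ hα p) by
    by_cases hB : z e = w ∧ z.symm e = α • w + κ • e
    · rw [if_pos hB, if_pos (hiff.1 hB)]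
    · rw [if_neg hB, if_neg (fun hc => hB (hiff.2 hc))]
  constructor
  · rintro ⟨h1, h2⟩ p
    have h3 : z (α • w + κ • e) = e := by rw [← h2]; simp
    have h4 : z w = α⁻¹ • e - (α⁻¹ * κ) • w := by
      rw [map_add, map_smul, map_smul, h1] at h3
      have h5 : z w = α⁻¹ • (α • z w) := by rw [smul_smul, inv_mul_cancel₀ hα, one_smul]
      rw [h5, eq_sub_of_add_eq h3]
      module
    rw [hi, hi, map_add, map_smul, map_smul, h1, h4]
    simp only [mkZ0, LinearEquiv.coe_mk, LinearMap.coe_mk, AddHom.coe_mk]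
    module
  · intro h
    have h1 := h (1, 0)
    have h2 := h (κ, α)
    rw [hi, hi] at h1 h2
    simp [mkZ0, hα] at h1 h2
    refine ⟨h1, ?_⟩
    rw [LinearEquiv.symm_apply_eq, map_add, map_smul, map_smul, h1, add_comm]
    rw [h1] at h2
    exact h2.symm

theorem mk_key (ψ : AddChar F ℂ) (hψ : ψ ≠ 1) (f : V →ₗ[F] V) (e : V) (he0 : e ≠ 0) (α : F)
    (hα : α ≠ 0) (he : f e = α • e) :
    mkK ψ f = (Nat.card F : ℂ) ^ (finrank F V - 1)
        * (∑ t : Fˣ, ψ (α * (t : F) + ((t⁻¹ : Fˣ) : F))) * mkKq ψ f (Submodule.span F {e})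
      + (Nat.card F : ℂ) ^ (2 * finrank F V - 3) * ∑ γ : F, ∑ w : V,
        if (w ∉ Submodule.span F {e} ∧ f w = α • w + γ • e) then
          ψ γ * mkKq ψ f (Submodule.span F {e, w}) else 0 := by
  have h0 : mkK ψ f = (∑ z : V ≃ₗ[F] V, if z e ∈ Submodule.span F {e} then mkE ψ f z else 0)
      + (∑ z : V ≃ₗ[F] V, if z e ∉ Submodule.span F {e} then mkE ψ f z else 0) := by
    rw [mkK, ← Finset.sum_add_distrib]
    refine Finset.sum_congr rfl fun z _ => ?_
    by_cases h : z e ∈ Submodule.span F {e} <;> simp [h]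
  rw [h0, mk_onP ψ f e he0 α he, mk_offP ψ hψ f e α he]
  congr 1
  have h1 : ∀ z : V ≃ₗ[F] V, (if ((z e ∉ Submodule.span F {e}
          ∧ f (z e) - z.symm e ∈ Submodule.span F {e})
          ∧ α • z e - z.symm e ∈ Submodule.span F {e}) then mkE ψ f z else 0)
      = ∑ γ : F, ∑ w : V, ∑ κ : F, if (w ∉ Submodule.span F {e} ∧ f w = α • w + γ • e) then
          (if (z e = w ∧ z.symm e = α • w + κ • e) then mkE ψ f z else 0) else 0 := by
    intro z
    split_ifs with hz
    · obtain ⟨⟨hz1, hz2⟩, hz3⟩ := hz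
      obtain ⟨c, hc⟩ := Submodule.mem_span_singleton.1 hz2
      obtain ⟨d, hd⟩ := Submodule.mem_span_singleton.1 hz3
      have e1 : z.symm e = α • z e + (-d) • e := by
        rw [neg_smul, hd]; abel
      have e2 : f (z e) = α • z e + (c - d) • e := by
        rw [sub_smul, hc, hd]; abel
      rw [Finset.sum_eq_single (c - d), Finset.sum_eq_single (z e), Finset.sum_eq_single (-d)]
      · rw [if_pos ⟨hz1, e2⟩, if_pos ⟨rfl, e1⟩]
      · intro κ _ hκ
        rw [if_pos ⟨hz1, e2⟩, if_neg]
        rintro ⟨-, h⟩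
        rw [e1] at h
        exact hκ (smul_left_injective F he0 (add_left_cancel h)).symm
      · simp
      · intro w _ hw
        apply Finset.sum_eq_zero
        intro κ _
        split_ifs with h3 h4
        · exact absurd h4.1.symm hw
        · rfl
        · rfl
      · simp
      · intro γ _ hγ
        apply Finset.sum_eq_zero
        intro w _
        apply Finset.sum_eq_zero
        intro κ _
        split_ifs with h3 h4
        · exfalso
          rw [← h4.1, e2] at h3
          exact hγ (smul_left_injective F he0 (add_left_cancel h3.2)).symm
        · rfl
        · rfl
      · simp
    · symm
      apply Finset.sum_eq_zero
      intro γ _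
      apply Finset.sum_eq_zero
      intro w _
      apply Finset.sum_eq_zero
      intro κ _
      split_ifs with h3 h4
      · exfalso
        apply hz
        obtain ⟨rfl, h4⟩ := h4
        refine ⟨⟨h3.1, ?_⟩, ?_⟩
        · rw [h3.2, h4, Submodule.mem_span_singleton]
          exact ⟨γ - κ, by module⟩
        · rw [h4, Submodule.mem_span_singleton]
          exact ⟨- κ, by module⟩
      · rfl
      · rfl
  simp only [h1]
  rw [Finset.sum_comm, Finset.mul_sum]
  refine Finset.sum_congr rfl fun γ _ => ?_
  rw [Finset.sum_comm, Finset.mul_sum]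
  refine Finset.sum_congr rfl fun w _ => ?_
  rw [Finset.sum_comm]
  split_ifs with h
  · have hn : 2 ≤ finrank F V := by
      have hli : LinearIndependent F ![e, w] :=
        LinearIndependent.pair_iff.2 fun s t hst => mk_pair e w he0 h.1 s t hst
      simpa using hli.fintype_card_le_finrank
    simp only [mk_two ψ f e w he0 α γ _ hα he h.1 h.2]
    rw [Finset.sum_const, Finset.card_univ, nsmul_eq_mul, Fintype.card_eq_nat_card]
    have : 2 * finrank F V - 3 = 1 + (finrank F V - 2) * 2 := by omega
    rw [this, pow_add]
    ring
  · simp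

theorem mk_count (R : Submodule F V) (c : ℂ) :
    (∑ w : V, if w ∈ R then c else 0) = (Nat.card F : ℂ) ^ (finrank F R) * c := by
  rw [← Finset.sum_filter, Finset.sum_const, nsmul_eq_mul]
  congr 1
  have : (Finset.univ.filter (fun w : V => w ∈ R)).card = Fintype.card R := by
    rw [Fintype.card_subtype]
  rw [this, Module.card_eq_pow_finrank (K := F), Fintype.card_eq_nat_card]
  push_cast
  rfl

theorem mk_count_sub (R L : Submodule F V) (hLR : L ≤ R) (c : ℂ) :
    (∑ w : V, if (w ∈ R ∧ w ∉ L) then c else 0)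
      = ((Nat.card F : ℂ) ^ (finrank F R) - (Nat.card F : ℂ) ^ (finrank F L)) * c := by
  rw [sub_mul, ← mk_count, ← mk_count, ← Finset.sum_sub_distrib]
  refine Finset.sum_congr rfl fun w _ => ?_
  by_cases h1 : w ∈ L
  · simp [h1, hLR h1]
  · simp [h1]

theorem mk_sum (ψ : AddChar F ℂ) (hψ : ψ ≠ 1) (N : Module.End F V) (r : ℕ) (hr : 1 ≤ r)
    (hN : N ^ r = 0) (v0 e : V) (he0 : e ≠ 0) (hv0 : e = (N ^ (r - 1)) v0) (g : V → ℂ) (K2 K3 : ℂ)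
    (H3 : ∀ w, w ∉ Submodule.span F {e} → w ∈ LinearMap.range (N ^ (r - 1)) → g w = K3)
    (H2 : 2 ≤ r → ∀ w, w ∉ Submodule.span F {e} → N w ∈ Submodule.span F {e} →
      w ∈ LinearMap.range (N ^ (r - 2)) → w ∉ LinearMap.range (N ^ (r - 1)) → g w = K2)
    (H1 : 2 ≤ r → ∀ k (γ : F), N k = 0 → k ∉ LinearMap.range (N ^ (r - 2)) →
      g (γ • (N ^ (r - 2)) v0 + k) = g k) :
    (∑ γ : F, ∑ w : V, if (w ∉ Submodule.span F {e} ∧ N w = γ • e) then ψ γ * g w else 0)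
      = ((Nat.card F : ℂ) ^ (finrank F (LinearMap.range (N ^ (r - 1)))) - (Nat.card F : ℂ)) * K3
        - (if 2 ≤ r then
          (Nat.card F : ℂ) ^ (finrank F (LinearMap.range (N ^ (r - 1)))) * K2 else 0) := by
  set L := Submodule.span F {e} with hL
  set R := LinearMap.range (N ^ (r - 1)) with hR
  have heR : e ∈ R := ⟨v0, hv0.symm⟩
  have hLR : L ≤ R := by
    rw [hL, Submodule.span_singleton_le_iff_mem]; exact heR
  have hfL : finrank F L = 1 := finrank_span_singleton he0
  have hNR : ∀ w ∈ R, N w = 0 := by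
    rintro _ ⟨v, rfl⟩
    have : (N * N ^ (r - 1)) v = 0 := by
      rw [← pow_succ', Nat.sub_add_cancel hr, hN]; rfl
    exact this
  have hcs := mk_count_sub R L hLR K3
  rw [hfL, pow_one] at hcs
  have hψ0 : ∑ γ : F, ψ γ = 0 := AddChar.sum_eq_zero_of_ne_one hψ
  by_cases h2 : 2 ≤ r
  · rw [if_pos h2, ← hcs]
    set R2 := LinearMap.range (N ^ (r - 2)) with hR2
    set u := (N ^ (r - 2)) v0 with hu
    have huR2 : u ∈ R2 := ⟨v0, rfl⟩
    have hRR2 : R ≤ R2 := by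
      rintro _ ⟨v, rfl⟩
      refine ⟨N v, ?_⟩
      have : r - 1 = (r - 2) + 1 := by omega
      rw [this, pow_succ]; rfl
    have hNu : N u = e := by
      rw [hv0, hu]
      have : r - 1 = (r - 2) + 1 := by omega
      rw [this, pow_succ']; rfl
    have hmemL : ∀ c : F, c • e ∈ L := fun c =>
      Submodule.smul_mem _ _ (Submodule.mem_span_singleton_self e)
    have h3 : ∀ γ : F, (∑ w : V, if (w ∉ L ∧ N w = γ • e) then ψ γ * g w else 0)
        = ∑ k : V, if (γ • u + k ∉ L ∧ N k = 0) then ψ γ * g (γ • u + k) else 0 := by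
      intro γ
      rw [← Equiv.sum_comp (Equiv.addLeft (γ • u))]
      refine Finset.sum_congr rfl fun k _ => ?_
      simp only [Equiv.coe_addLeft, map_add, map_smul, hNu, add_eq_left]
    simp only [h3]
    rw [Finset.sum_comm, ← mk_count, ← Finset.sum_sub_distrib]
    refine Finset.sum_congr rfl fun k _ => ?_
    by_cases hk : N k = 0
    swap
    · have hkR : k ∉ R := fun h => hk (hNR k h)
      simp [hk, hkR]
    by_cases hk2 : k ∈ R2
    swap
    · have hkR : k ∉ R := fun h => hk2 (hRR2 h)
      have h4 : ∀ γ : F, γ • u + k ∉ L := by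
        intro γ h
        apply hk2
        have := R2.sub_mem (hRR2 (hLR h)) (R2.smul_mem γ huR2)
        simpa using this
      simp only [h4, hk, H1 h2 k _ hk hk2, not_false_eq_true, and_self, if_true, hkR, false_and,
        if_false, sub_zero]
      rw [← Finset.sum_mul, hψ0, zero_mul]
    · have h5 : ∀ γ : F, (if (γ • u + k ∉ L ∧ N k = 0) then ψ γ * g (γ • u + k) else 0)
          = ψ γ * K2 + if γ = 0 then ((if k ∈ L then 0 else g k) - K2) else 0 := by
        intro γ
        by_cases hγ : γ = 0
        · subst hγ
          by_cases hkL : k ∈ L <;> simp [hk, hkL]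
        · have hNw : N (γ • u + k) = γ • e := by simp [hk, hNu]
          have hwR : γ • u + k ∉ R := by
            intro h
            have := hNR _ h
            rw [hNw] at this
            exact (smul_ne_zero hγ he0) this
          have hwL : γ • u + k ∉ L := fun h => hwR (hLR h)
          rw [if_pos ⟨hwL, hk⟩, if_neg hγ, add_zero,
            H2 h2 _ hwL (by rw [hNw]; exact hmemL γ) (R2.add_mem (R2.smul_mem γ huR2) hk2) hwR]
      simp only [h5]
      rw [Finset.sum_add_distrib, ← Finset.sum_mul, hψ0, zero_mul, zero_add, Finset.sum_ite_eq']
      simp only [Finset.mem_univ, if_true]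
      by_cases hkL : k ∈ L
      · simp [hkL, hLR hkL]
      · by_cases hkR : k ∈ R
        · simp [hkL, hkR, H3 k hkL hkR]
        · simp [hkL, hkR, H2 h2 k hkL (by rw [hk]; exact L.zero_mem) hk2 hkR]
  · have hr1 : r = 1 := by omega
    rw [if_neg h2, sub_zero, ← hcs]
    subst hr1
    have hN0 : ∀ w, N w = 0 := fun w => by
      rw [pow_one] at hN; rw [hN]; rfl
    have hall : ∀ w, w ∈ R := fun w => ⟨w, by simp⟩
    rw [Finset.sum_eq_single 0]
    · refine Finset.sum_congr rfl fun w _ => ?_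
      by_cases hw : w ∈ L
      · simp [hw]
      · simp [hw, hN0, hall, H3 w hw (hall w)]
    · intro γ _ hγ
      apply Finset.sum_eq_zero
      intro w _
      rw [if_neg]
      rintro ⟨-, h⟩
      rw [hN0] at h
      exact (smul_ne_zero hγ he0) h.symm
    · simp

/-- the nilpotent part -/
noncomputable def mkN (α : F) (f : V →ₗ[F] V) : Module.End F V := f - α • LinearMap.id

theorem mkN_apply (α : F) (f : V →ₗ[F] V) (v : V) : mkN α f v = f v - α • v := rfl

/-- kernel dimensions -/
noncomputable def mkD (α : F) (f : V →ₗ[F] V) (j : ℕ) : ℕ :=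
  finrank F (LinearMap.ker (mkN α f ^ j))

theorem mk_finrank_map (S : Submodule F V) (h : V →ₗ[F] Q) (hS : LinearMap.ker h ≤ S) :
    finrank F (S.map h) + finrank F (LinearMap.ker h) = finrank F S := by
  have h1 := (h.domRestrict S).finrank_range_add_finrank_ker
  rw [LinearMap.range_domRestrict, LinearMap.ker_domRestrict] at h1
  rw [← h1, ← Submodule.finrank_map_subtype_eq S, Submodule.map_comap_subtype,
    inf_eq_right.2 hS]

theorem mk_quotD (α : F) (f : V →ₗ[F] V) (W : Submodule F V) (hW : W ≤ W.comap f) (j : ℕ) :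
    mkD α (W.mapQ W f hW) j + finrank F W
      = mkD α f j + finrank F (W ⊓ LinearMap.range (mkN α f ^ j) : Submodule F V) := by
  have hWN : W ≤ W.comap (mkN α f) := fun v hv => by
    change f v - α • v ∈ W
    exact W.sub_mem (hW hv) (W.smul_mem α hv)
  have h1 : mkN α (W.mapQ W f hW) = W.mapQ W (mkN α f) hWN := by
    apply LinearMap.ext
    intro x
    obtain ⟨v, rfl⟩ := W.mkQ_surjective x
    rfl
  have hWj : W ≤ W.comap (mkN α f ^ j) := W.le_comap_pow_of_le_comap hWN j
  unfold mkD
  rw [h1, ← Submodule.mapQ_pow W hWN j, Submodule.ker_mapQ]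
  have h2 := mk_finrank_map (W.comap (mkN α f ^ j)) W.mkQ (by rw [Submodule.ker_mkQ]; exact hWj)
  rw [Submodule.ker_mkQ] at h2
  rw [h2]
  have h3 := mk_finrank_map (W.comap (mkN α f ^ j)) (mkN α f ^ j)
    (by intro v hv; rw [Submodule.mem_comap, LinearMap.mem_ker.1 hv]; exact W.zero_mem)
  rw [Submodule.map_comap_eq] at h3
  rw [← h3, add_comm, inf_comm]

theorem mk_quot1 (α : F) (f : V →ₗ[F] V) (r : ℕ) (hr : 1 ≤ r) (hN : mkN α f ^ r = 0)
    (v0 e : V) (he0 : e ≠ 0) (hv0 : e = (mkN α f ^ (r - 1)) v0) :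
    ∃ hW : Submodule.span F {e} ≤ (Submodule.span F {e}).comap f,
      finrank F (V ⧸ Submodule.span F {e}) + 1 = finrank F V ∧
      ∀ j, mkD α (Submodule.mapQ (Submodule.span F {e}) (Submodule.span F {e}) f hW) j + 1
        = mkD α f j + if j < r then 1 else 0 := by
  have hNe : mkN α f e = 0 := by
    have : (mkN α f * mkN α f ^ (r - 1)) v0 = 0 := by
      rw [← pow_succ', Nat.sub_add_cancel hr, hN]; rfl
    rw [hv0]; exact this
  have hfe : f e = α • e := by rw [mkN_apply] at hNe; exact sub_eq_zero.1 hNe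
  have hW : Submodule.span F {e} ≤ (Submodule.span F {e}).comap f := by
    rw [Submodule.span_singleton_le_iff_mem, Submodule.mem_comap, hfe]
    exact Submodule.smul_mem _ _ (Submodule.mem_span_singleton_self e)
  have h1 : finrank F (Submodule.span F {e}) = 1 := finrank_span_singleton he0
  refine ⟨hW, ?_, ?_⟩
  · rw [← Submodule.finrank_quotient_add_finrank (Submodule.span F {e}), h1]
  · intro j
    have := mk_quotD α f _ hW j
    rw [h1] at this
    rw [this]
    congr 1
    split_ifs with hj
    · rw [inf_eq_left.2, h1]
      rw [Submodule.span_singleton_le_iff_mem, hv0]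
      refine ⟨(mkN α f ^ (r - 1 - j)) v0, ?_⟩
      have : r - 1 = j + (r - 1 - j) := by omega
      rw [← Module.End.mul_apply, ← pow_add, ← this]
    · have : mkN α f ^ j = 0 := pow_eq_zero_of_le (not_lt.1 hj) hN
      rw [this]
      simp

theorem mk_pair_finrank (e w : V) (he0 : e ≠ 0) (hw : w ∉ Submodule.span F {e}) :
    finrank F (Submodule.span F {e, w}) = 2 := by
  have hli : LinearIndependent F ![e, w] :=
    LinearIndependent.pair_iff.2 fun s t hst => mk_pair e w he0 hw s t hst
  have h := finrank_span_eq_card hli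
  have hset : Set.range ![e, w] = {e, w} := by
    rw [Matrix.range_cons, Matrix.range_cons, Matrix.range_empty, Set.union_empty,
      Set.singleton_union]
  rw [hset] at h
  simpa using h

theorem mk_quot2 (α : F) (f : V →ₗ[F] V) (r : ℕ) (hr : 1 ≤ r) (hN : mkN α f ^ r = 0)
    (v0 e : V) (he0 : e ≠ 0) (hv0 : e = (mkN α f ^ (r - 1)) v0) (w : V)
    (hw : w ∉ Submodule.span F {e}) (hNw : mkN α f w ∈ Submodule.span F {e}) :
    ∃ hW : Submodule.span F {e, w} ≤ (Submodule.span F {e, w}).comap f,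
      finrank F (V ⧸ Submodule.span F {e, w}) + 2 = finrank F V ∧
      ∀ j, mkD α (Submodule.mapQ (Submodule.span F {e, w}) (Submodule.span F {e, w}) f hW) j + 2
        = mkD α f j + ((if j < r then 1 else 0)
          + (if w ∈ LinearMap.range (mkN α f ^ j) then 1 else 0)) := by
  have hNe : mkN α f e = 0 := by
    have : (mkN α f * mkN α f ^ (r - 1)) v0 = 0 := by
      rw [← pow_succ', Nat.sub_add_cancel hr, hN]; rfl
    rw [hv0]; exact this
  have hfe : f e = α • e := by rw [mkN_apply] at hNe; exact sub_eq_zero.1 hNe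
  have heW : e ∈ Submodule.span F {e, w} := Submodule.subset_span (by simp)
  have hwW : w ∈ Submodule.span F {e, w} := Submodule.subset_span (by simp)
  have hLW : Submodule.span F {e} ≤ Submodule.span F {e, w} := by
    rw [Submodule.span_singleton_le_iff_mem]; exact heW
  have hW : Submodule.span F {e, w} ≤ (Submodule.span F {e, w}).comap f := by
    rw [Submodule.span_le]
    intro x hx
    rcases hx with hx | hx
    · rw [hx]
      change f e ∈ Submodule.span F {e, w}
      rw [hfe]
      exact Submodule.smul_mem _ _ heW
    · rw [Set.mem_singleton_iff.1 hx]
      change f w ∈ Submodule.span F {e, w}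
      have := Submodule.add_mem _ (hLW hNw) (Submodule.smul_mem _ α hwW)
      rw [mkN_apply, sub_add_cancel] at this
      exact this
  have h2 : finrank F (Submodule.span F {e, w}) = 2 := mk_pair_finrank e w he0 hw
  have h1 : finrank F (Submodule.span F {e}) = 1 := finrank_span_singleton he0
  refine ⟨hW, ?_, ?_⟩
  · rw [← Submodule.finrank_quotient_add_finrank (Submodule.span F {e, w}), h2]
  · intro j
    have := mk_quotD α f _ hW j
    rw [h2] at this
    rw [this]
    congr 1
    by_cases hj : j < r
    · have heR : e ∈ LinearMap.range (mkN α f ^ j) := by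
        rw [hv0]
        refine ⟨(mkN α f ^ (r - 1 - j)) v0, ?_⟩
        have : r - 1 = j + (r - 1 - j) := by omega
        rw [← Module.End.mul_apply, ← pow_add, ← this]
      rw [if_pos hj]
      split_ifs with hwR
      · rw [inf_eq_left.2, h2]
        rw [Submodule.span_le]
        intro x hx
        rcases hx with rfl | rfl
        · exact heR
        · exact hwR
      · have : Submodule.span F {e, w} ⊓ LinearMap.range (mkN α f ^ j) = Submodule.span F {e} := by
          apply le_antisymm
          · rintro x ⟨hx1, hx2⟩
            obtain ⟨s, t, rfl⟩ := Submodule.mem_span_pair.1 hx1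
            have h3 : t • w ∈ LinearMap.range (mkN α f ^ j) := by
              have := Submodule.sub_mem _ hx2 (Submodule.smul_mem _ s heR)
              simpa using this
            have ht : t = 0 := by
              by_contra ht
              exact hwR ((Submodule.smul_mem_iff _ ht).1 h3)
            subst ht
            rw [zero_smul, add_zero]
            exact Submodule.smul_mem _ _ (Submodule.mem_span_singleton_self e)
          · refine le_inf hLW ?_
            rw [Submodule.span_singleton_le_iff_mem]
            exact heR
        rw [this, h1]
    · have : mkN α f ^ j = 0 := pow_eq_zero_of_le (not_lt.1 hj) hN
      have hw0 : w ≠ 0 := by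
        rintro rfl
        exact hw (Submodule.zero_mem _)
      rw [this]
      simp [hw0, hj]

/-- the Kloosterman sum depends only on the type, in dimension `n` -/
def mkInv (ψ : AddChar F ℂ) (α : F) (n : ℕ) : Prop :=
  ∀ (V₁ V₂ : Type) [AddCommGroup V₁] [Module F V₁] [Finite V₁] [AddCommGroup V₂] [Module F V₂]
    [Finite V₂] (f₁ : V₁ →ₗ[F] V₁) (f₂ : V₂ →ₗ[F] V₂), finrank F V₁ = n → finrank F V₂ = n →
    (∃ s, mkD α f₁ s = n) → (∀ j, mkD α f₁ j = mkD α f₂ j) → mkK ψ f₁ = mkK ψ f₂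

theorem mkD_eq_iff (α : F) (f : V →ₗ[F] V) (j : ℕ) :
    mkD α f j = finrank F V ↔ mkN α f ^ j = 0 := by
  unfold mkD
  constructor
  · intro h
    have := Submodule.eq_top_of_finrank_eq h
    exact LinearMap.ker_eq_top.1 this
  · intro h
    rw [h, LinearMap.ker_zero, finrank_top]

theorem mkD_range (α : F) (f : V →ₗ[F] V) (j : ℕ) :
    finrank F (LinearMap.range (mkN α f ^ j)) + mkD α f j = finrank F V :=
  LinearMap.finrank_range_add_finrank_ker _

theorem mk_step (ψ : AddChar F ℂ) (hψ : ψ ≠ 1) (α : F) (hα : α ≠ 0) (n : ℕ)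
    (I1 : mkInv ψ α (n - 1)) (I2 : mkInv ψ α (n - 2)) (f : V →ₗ[F] V) (hn : finrank F V = n)
    (r : ℕ) (hr : 1 ≤ r) (hN : mkN α f ^ r = 0) (hN' : mkN α f ^ (r - 1) ≠ 0)
    (V₁ : Type) [AddCommGroup V₁] [Module F V₁] [Finite V₁] (f₁ : V₁ →ₗ[F] V₁)
    (hn₁ : finrank F V₁ + 1 = n)
    (hD₁ : ∀ j, mkD α f₁ j + 1 = mkD α f j + if j < r then 1 else 0)
    (K2 K3 : ℂ)
    (h2 : 2 ≤ r → ∃ (V₂ : Type) (_ : AddCommGroup V₂) (_ : Module F V₂) (_ : Finite V₂)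
      (f₂ : V₂ →ₗ[F] V₂), finrank F V₂ + 2 = n ∧ (∀ j, mkD α f₂ j + 2 = mkD α f j +
        ((if j < r then 1 else 0) + (if j + 1 < r then 1 else 0))) ∧ mkK ψ f₂ = K2)
    (h3 : 2 ≤ finrank F (LinearMap.range (mkN α f ^ (r - 1))) →
      ∃ (V₂ : Type) (_ : AddCommGroup V₂) (_ : Module F V₂) (_ : Finite V₂)
      (f₂ : V₂ →ₗ[F] V₂), finrank F V₂ + 2 = n ∧ (∀ j, mkD α f₂ j + 2 = mkD α f j +
        ((if j < r then 1 else 0) + (if j < r then 1 else 0))) ∧ mkK ψ f₂ = K3) :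
    mkK ψ f = (Nat.card F : ℂ) ^ (n - 1)
        * (∑ t : Fˣ, ψ (α * (t : F) + ((t⁻¹ : Fˣ) : F))) * mkK ψ f₁
      + (Nat.card F : ℂ) ^ (2 * n - 3) *
      (((Nat.card F : ℂ) ^ (finrank F (LinearMap.range (mkN α f ^ (r - 1)))) - (Nat.card F : ℂ)) * K3
        - (if 2 ≤ r then
          (Nat.card F : ℂ) ^ (finrank F (LinearMap.range (mkN α f ^ (r - 1)))) * K2 else 0)) := by
  obtain ⟨v0, hv⟩ : ∃ v0, (mkN α f ^ (r - 1)) v0 ≠ 0 := by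
    by_contra h
    push Not at h
    exact hN' (LinearMap.ext h)
  obtain ⟨e, hv0⟩ : ∃ e, e = (mkN α f ^ (r - 1)) v0 := ⟨_, rfl⟩
  have he0 : e ≠ 0 := by rw [hv0]; exact hv
  have hNe : mkN α f e = 0 := by
    have : (mkN α f * mkN α f ^ (r - 1)) v0 = 0 := by
      rw [← pow_succ', Nat.sub_add_cancel hr, hN]; rfl
    rw [hv0]; exact this
  have hfe : f e = α • e := by rw [mkN_apply] at hNe; exact sub_eq_zero.1 hNe
  have hDr : mkD α f r = n := by rw [← hn]; exact (mkD_eq_iff α f r).2 hN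
  have hrange : ∀ {i j : ℕ}, i ≤ j → LinearMap.range (mkN α f ^ j) ≤ LinearMap.range (mkN α f ^ i) := by
    rintro i j hij _ ⟨v, rfl⟩
    refine ⟨(mkN α f ^ (j - i)) v, ?_⟩
    rw [← Module.End.mul_apply, ← pow_add, Nat.add_sub_cancel' hij]
  have hbig : ∀ w, w ∉ Submodule.span F {e} → ∀ j, w ∈ LinearMap.range (mkN α f ^ j) → j < r := by
    intro w hw j hj
    by_contra hjr
    have : mkN α f ^ j = 0 := pow_eq_zero_of_le (not_lt.1 hjr) hN
    rw [this, LinearMap.range_zero, Submodule.mem_bot] at hj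
    rw [hj] at hw
    exact hw (Submodule.zero_mem _)
  have cmp : ∀ (w : V), w ∉ Submodule.span F {e} → mkN α f w ∈ Submodule.span F {e} →
      ∀ (V₂ : Type) [AddCommGroup V₂] [Module F V₂] [Finite V₂] (f₂ : V₂ →ₗ[F] V₂),
      finrank F V₂ + 2 = n → (∀ j, mkD α f₂ j + 2 = mkD α f j +
        ((if j < r then 1 else 0) + (if w ∈ LinearMap.range (mkN α f ^ j) then 1 else 0))) →
      mkKq ψ f (Submodule.span F {e, w}) = mkK ψ f₂ := by
    intro w hw hNw V₂ _ _ _ f₂ hn₂ hD₂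
    obtain ⟨hW, hd, hD⟩ := mk_quot2 α f r hr hN v0 e he0 hv0 w hw hNw
    rw [mkKq, dif_pos hW]
    refine I2 _ _ _ _ (by omega) (by omega) ⟨r, ?_⟩ ?_
    · have := hD r
      rw [hDr, if_neg (lt_irrefl r), if_neg (fun h => lt_irrefl r (hbig w hw r h))] at this
      omega
    · intro j
      have e1 := hD j
      have e2 := hD₂ j
      omega
  rw [mk_key ψ hψ f e he0 α hα hfe, hn]
  have c1 : mkKq ψ f (Submodule.span F {e}) = mkK ψ f₁ := by
    obtain ⟨hW, hd, hD⟩ := mk_quot1 α f r hr hN v0 e he0 hv0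
    rw [mkKq, dif_pos hW]
    refine I1 _ _ _ _ (by omega) (by omega) ⟨r, ?_⟩ ?_
    · have := hD r
      rw [hDr, if_neg (lt_irrefl r)] at this
      omega
    · intro j
      have e1 := hD j
      have e2 := hD₁ j
      omega
  rw [c1]
  congr 2
  have hcond : ∀ (w : V) (γ : F), f w = α • w + γ • e ↔ mkN α f w = γ • e := by
    intro w γ
    rw [mkN_apply, sub_eq_iff_eq_add, add_comm]
  simp only [hcond]
  refine mk_sum ψ hψ (mkN α f) r hr hN v0 e he0 hv0
    (fun w => mkKq ψ f (Submodule.span F {e, w})) K2 K3 ?_ ?_ ?_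
  · intro w hw hwR
    have hNw : mkN α f w = 0 := by
      obtain ⟨v, rfl⟩ := hwR
      have : (mkN α f * mkN α f ^ (r - 1)) v = 0 := by
        rw [← pow_succ', Nat.sub_add_cancel hr, hN]; rfl
      exact this
    have hdim : 2 ≤ finrank F (LinearMap.range (mkN α f ^ (r - 1))) := by
      have h4 : finrank F (Submodule.span F {e, w}) = 2 := mk_pair_finrank e w he0 hw
      rw [← h4]
      apply Submodule.finrank_mono
      rw [Submodule.span_le]
      intro x hx
      rcases hx with rfl | rfl
      · exact ⟨v0, hv0.symm⟩
      · exact hwR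
    obtain ⟨V₂, _, _, _, f₂, hn₂, hD₂, rfl⟩ := h3 hdim
    refine cmp w hw (by rw [hNw]; exact Submodule.zero_mem _) V₂ f₂ hn₂ fun j => ?_
    rw [hD₂ j]
    by_cases hj : j < r
    · rw [if_pos hj, if_pos (hrange (by omega) hwR)]
    · rw [if_neg hj, if_neg (fun h => hj (hbig w hw j h))]
  · intro hr2 w hw hNw hwR hwR'
    obtain ⟨V₂, _, _, _, f₂, hn₂, hD₂, rfl⟩ := h2 hr2
    refine cmp w hw hNw V₂ f₂ hn₂ fun j => ?_
    rw [hD₂ j]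
    by_cases hj : j + 1 < r
    · rw [if_pos hj, if_pos (hrange (by omega) hwR)]
    · rw [if_neg hj, if_neg (fun h => hwR' (hrange (by omega) h))]
  · intro hr2 k γ hk hkR
    have huR : (mkN α f ^ (r - 2)) v0 ∈ LinearMap.range (mkN α f ^ (r - 2)) := ⟨v0, rfl⟩
    have hLR : Submodule.span F {e} ≤ LinearMap.range (mkN α f ^ (r - 2)) := by
      rw [Submodule.span_singleton_le_iff_mem]
      exact hrange (show r - 2 ≤ r - 1 by omega) ⟨v0, hv0.symm⟩
    have hkL : k ∉ Submodule.span F {e} := fun h => hkR (hLR h)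
    have hiff : ∀ j, j ≤ r - 2 → (γ • (mkN α f ^ (r - 2)) v0 + k ∈ LinearMap.range (mkN α f ^ j)
        ↔ k ∈ LinearMap.range (mkN α f ^ j)) := fun j hj =>
      Submodule.add_mem_iff_right _ (Submodule.smul_mem _ _ (hrange hj huR))
    have hwR : γ • (mkN α f ^ (r - 2)) v0 + k ∉ LinearMap.range (mkN α f ^ (r - 2)) := fun h =>
      hkR ((hiff _ le_rfl).1 h)
    have hwL : γ • (mkN α f ^ (r - 2)) v0 + k ∉ Submodule.span F {e} := fun h => hwR (hLR h)
    have hNw : mkN α f (γ • (mkN α f ^ (r - 2)) v0 + k) ∈ Submodule.span F {e} := by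
      have hNu : mkN α f ((mkN α f ^ (r - 2)) v0) = e := by
        rw [hv0]
        have : r - 1 = (r - 2) + 1 := by omega
        rw [this, pow_succ']; rfl
      rw [map_add, map_smul, hNu, hk, add_zero]
      exact Submodule.smul_mem _ _ (Submodule.mem_span_singleton_self e)
    obtain ⟨hW, hd, hD⟩ := mk_quot2 α f r hr hN v0 e he0 hv0 k hkL
      (by rw [hk]; exact Submodule.zero_mem _)
    rw [cmp _ hwL hNw _ (Submodule.mapQ _ _ f hW) (by omega) (fun j => ?_)]
    · rw [mkKq, dif_pos hW]
    · rw [hD j]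
      congr 2
      by_cases hj : j ≤ r - 2
      · simp only [hiff j hj]
      · rw [if_neg (fun h => hwR (hrange (by omega) h)), if_neg (fun h => hkR (hrange (by omega) h))]

theorem mkK_zero (ψ : AddChar F ℂ) (f : V →ₗ[F] V) (h : finrank F V = 0) : mkK ψ f = 1 := by
  have hs : Subsingleton V := finrank_zero_iff.1 h
  have h0 : ∀ g : V →ₗ[F] V, LinearMap.trace F V g = 0 := fun g => by
    have : g = 0 := LinearMap.ext fun v => Subsingleton.elim _ _
    rw [this, map_zero]
  have h1 : ∀ z : V ≃ₗ[F] V, z = LinearEquiv.refl F V := fun z =>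
    LinearEquiv.ext fun v => Subsingleton.elim _ _
  rw [mkK, Fintype.sum_eq_single (LinearEquiv.refl F V) (fun z hz => absurd (h1 z) hz)]
  simp [mkE, h0]

theorem mk_inv (ψ : AddChar F ℂ) (hψ : ψ ≠ 1) (α : F) (hα : α ≠ 0) (n : ℕ) : mkInv ψ α n := by
  induction n using Nat.strong_induction_on with
  | _ n IH =>
  intro V₁ V₂ _ _ _ _ _ _ f₁ f₂ hn₁ hn₂ hex hD
  rcases Nat.eq_zero_or_pos n with rfl | hpos
  · rw [mkK_zero ψ f₁ hn₁, mkK_zero ψ f₂ hn₂]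
  by_cases hn1 : n - 1 < n
  swap
  · omega
  have I1 := IH (n - 1) hn1
  have I2 := IH (n - 2) (by omega)
  obtain ⟨r, hr0, hmin⟩ : ∃ r, mkD α f₁ r = n ∧ ∀ s < r, mkD α f₁ s ≠ n :=
    ⟨Nat.find hex, Nat.find_spec hex, fun s hs => Nat.find_min hex hs⟩
  have hr : 1 ≤ r := by
    rcases Nat.eq_zero_or_pos r with rfl | h
    · exfalso
      have : mkD α f₁ 0 = 0 := by
        unfold mkD
        rw [pow_zero, Module.End.one_eq_id, LinearMap.ker_id, finrank_bot]
      omega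
    · exact h
  have hN1 : mkN α f₁ ^ r = 0 := (mkD_eq_iff α f₁ r).1 (by rw [hr0, hn₁])
  have hN1' : mkN α f₁ ^ (r - 1) ≠ 0 := fun h =>
    hmin (r - 1) (by omega) (by rw [(mkD_eq_iff α f₁ (r - 1)).2 h, hn₁])
  have hN2 : mkN α f₂ ^ r = 0 := (mkD_eq_iff α f₂ r).1 (by rw [← hD, hr0, hn₂])
  have hN2' : mkN α f₂ ^ (r - 1) ≠ 0 := fun h =>
    hmin (r - 1) (by omega) (by rw [hD, (mkD_eq_iff α f₂ (r - 1)).2 h, hn₂])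
  obtain ⟨v0, hv⟩ : ∃ v0, (mkN α f₁ ^ (r - 1)) v0 ≠ 0 := by
    by_contra h
    push Not at h
    exact hN1' (LinearMap.ext h)
  obtain ⟨e, hv0⟩ : ∃ e, e = (mkN α f₁ ^ (r - 1)) v0 := ⟨_, rfl⟩
  have he0 : e ≠ 0 := by rw [hv0]; exact hv
  have hrange : ∀ {i j : ℕ}, i ≤ j →
      LinearMap.range (mkN α f₁ ^ j) ≤ LinearMap.range (mkN α f₁ ^ i) := by
    rintro i j hij _ ⟨v, rfl⟩
    refine ⟨(mkN α f₁ ^ (j - i)) v, ?_⟩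
    rw [← Module.End.mul_apply, ← pow_add, Nat.add_sub_cancel' hij]
  have hNR : ∀ w ∈ LinearMap.range (mkN α f₁ ^ (r - 1)), mkN α f₁ w = 0 := by
    rintro _ ⟨v, rfl⟩
    have : (mkN α f₁ * mkN α f₁ ^ (r - 1)) v = 0 := by
      rw [← pow_succ', Nat.sub_add_cancel hr, hN1]; rfl
    exact this
  have hLR : Submodule.span F {e} ≤ LinearMap.range (mkN α f₁ ^ (r - 1)) := by
    rw [Submodule.span_singleton_le_iff_mem]
    exact ⟨v0, hv0.symm⟩
  obtain ⟨hW, hd, hDq⟩ := mk_quot1 α f₁ r hr hN1 v0 e he0 hv0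
  obtain ⟨K2, h2⟩ : ∃ K2, (2 ≤ r → ∃ (V₂ : Type) (_ : AddCommGroup V₂) (_ : Module F V₂)
      (_ : Finite V₂)
      (f₂ : V₂ →ₗ[F] V₂), finrank F V₂ + 2 = n ∧ (∀ j, mkD α f₂ j + 2 = mkD α f₁ j +
        ((if j < r then 1 else 0) + (if j + 1 < r then 1 else 0))) ∧ mkK ψ f₂ = K2) := by
    by_cases hr2 : 2 ≤ r
    swap
    · exact ⟨0, fun h => absurd h hr2⟩
    have hNu : mkN α f₁ ((mkN α f₁ ^ (r - 2)) v0) = e := by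
      rw [hv0]
      have : r - 1 = (r - 2) + 1 := by omega
      rw [this, pow_succ']; rfl
    have huR : (mkN α f₁ ^ (r - 2)) v0 ∉ LinearMap.range (mkN α f₁ ^ (r - 1)) := fun h =>
      he0 (by rw [← hNu]; exact hNR _ h)
    obtain ⟨hW2, hd2, hD2⟩ := mk_quot2 α f₁ r hr hN1 v0 e he0 hv0 ((mkN α f₁ ^ (r - 2)) v0)
      (fun h => huR (hLR h)) (by rw [hNu]; exact Submodule.mem_span_singleton_self e)
    refine ⟨_, fun _ => ⟨_, _, _, inferInstance, Submodule.mapQ _ _ f₁ hW2, by omega, ?_, rfl⟩⟩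
    intro j
    rw [hD2]
    congr 2
    by_cases hj : j + 1 < r
    · rw [if_pos hj, if_pos (hrange (show j ≤ r - 2 by omega) ⟨v0, rfl⟩)]
    · rw [if_neg hj, if_neg (fun h => huR (hrange (by omega) h))]
  obtain ⟨K3, h3⟩ : ∃ K3, (2 ≤ finrank F (LinearMap.range (mkN α f₁ ^ (r - 1))) →
      ∃ (V₂ : Type) (_ : AddCommGroup V₂) (_ : Module F V₂) (_ : Finite V₂)
      (f₂ : V₂ →ₗ[F] V₂), finrank F V₂ + 2 = n ∧ (∀ j, mkD α f₂ j + 2 = mkD α f₁ j +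
        ((if j < r then 1 else 0) + (if j < r then 1 else 0))) ∧ mkK ψ f₂ = K3) := by
    by_cases hm : 2 ≤ finrank F (LinearMap.range (mkN α f₁ ^ (r - 1)))
    swap
    · exact ⟨0, fun h => absurd h hm⟩
    obtain ⟨w, hwR, hwL⟩ : ∃ w ∈ LinearMap.range (mkN α f₁ ^ (r - 1)), w ∉ Submodule.span F {e} := by
      by_contra h
      push Not at h
      have h5 := Submodule.finrank_mono (show LinearMap.range (mkN α f₁ ^ (r - 1))
        ≤ Submodule.span F {e} from h)
      rw [finrank_span_singleton he0] at h5
      omega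
    obtain ⟨hW2, hd2, hD2⟩ := mk_quot2 α f₁ r hr hN1 v0 e he0 hv0 w hwL
      (by rw [hNR w hwR]; exact Submodule.zero_mem _)
    refine ⟨_, fun _ => ⟨_, _, _, inferInstance, Submodule.mapQ _ _ f₁ hW2, by omega, ?_, rfl⟩⟩
    intro j
    rw [hD2]
    congr 2
    by_cases hj : j < r
    · rw [if_pos hj, if_pos (hrange (by omega) hwR)]
    · have h6 : mkN α f₁ ^ j = 0 := pow_eq_zero_of_le (not_lt.1 hj) hN1
      rw [if_neg hj, if_neg]
      intro h
      rw [h6, LinearMap.range_zero, Submodule.mem_bot] at h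
      rw [h] at hwL
      exact hwL (Submodule.zero_mem _)
  have hm : finrank F (LinearMap.range (mkN α f₂ ^ (r - 1)))
      = finrank F (LinearMap.range (mkN α f₁ ^ (r - 1))) := by
    have e1 := mkD_range α f₁ (r - 1)
    have e2 := mkD_range α f₂ (r - 1)
    rw [hn₁, hD] at e1
    rw [hn₂] at e2
    omega
  rw [mk_step ψ hψ α hα n I1 I2 f₁ hn₁ r hr hN1 hN1' _ (Submodule.mapQ _ _ f₁ hW) (by omega) hDq
      K2 K3 h2 h3,
    mk_step ψ hψ α hα n I1 I2 f₂ hn₂ r hr hN2 hN2' _ (Submodule.mapQ _ _ f₁ hW) (by omega)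
      (fun j => by rw [← hD]; exact hDq j)
      K2 K3 (by simpa only [hD] using h2) (by rw [hm]; simpa only [hD] using h3), hm]

theorem mkD_ge (α : F) (f : V →ₗ[F] V) (r j : ℕ) (hrj : r ≤ j) (h : mkD α f r = finrank F V) :
    mkD α f j = finrank F V := by
  rw [mkD_eq_iff] at h ⊢
  exact pow_eq_zero_of_le hrj h

theorem mkD_zero (α : F) (f : V →ₗ[F] V) : mkD α f 0 = 0 := by
  unfold mkD
  rw [pow_zero, Module.End.one_eq_id, LinearMap.ker_id, finrank_bot]

theorem mk_final (ψ : AddChar F ℂ) (hψ : ψ ≠ 1) (α : F) (hα : α ≠ 0) (n : ℕ)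
    (f : V →ₗ[F] V) (hn : finrank F V = n)
    (r : ℕ) (hr : 1 ≤ r) (hN : mkN α f ^ r = 0) (hN' : mkN α f ^ (r - 1) ≠ 0)
    (V₁ : Type) [AddCommGroup V₁] [Module F V₁] [Finite V₁] (f₁ : V₁ →ₗ[F] V₁)
    (hn₁ : finrank F V₁ + 1 = n)
    (hD₁ : ∀ j, mkD α f₁ j + 1 = mkD α f j + if j < r then 1 else 0)
    (V₂ : Type) [AddCommGroup V₂] [Module F V₂] [Finite V₂] (f₂ : V₂ →ₗ[F] V₂)
    (hn₂ : 2 ≤ r → finrank F V₂ + 2 = n)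
    (hD₂ : 2 ≤ r → ∀ j, mkD α f₂ j + 2 = mkD α f j +
        ((if j < r then 1 else 0) + (if j + 1 < r then 1 else 0)))
    (m : ℕ) (hm : finrank F (LinearMap.range (mkN α f ^ (r - 1))) = m)
    (V₃ : Type) [AddCommGroup V₃] [Module F V₃] [Finite V₃] (f₃ : V₃ →ₗ[F] V₃)
    (hn₃ : 2 ≤ m → finrank F V₃ + 2 = n)
    (hD₃ : 2 ≤ m → ∀ j, mkD α f₃ j + 2 = mkD α f j +
        ((if j < r then 1 else 0) + (if j < r then 1 else 0))) :
    mkK ψ f = (Nat.card F : ℂ) ^ (n - 1)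
        * (∑ t : Fˣ, ψ (α * (t : F) + ((t⁻¹ : Fˣ) : F))) * mkK ψ f₁
      - (Nat.card F : ℂ) ^ (2 * n + m - 3) * (if 2 ≤ r then mkK ψ f₂ else 0)
      + ((Nat.card F : ℂ) ^ (m - 1) - 1) * (Nat.card F : ℂ) ^ (2 * n - 2)
        * (if 2 ≤ m then mkK ψ f₃ else 0) := by
  have hm1 : 1 ≤ m := by
    rw [← hm, Nat.one_le_iff_ne_zero]
    intro h
    rw [Submodule.finrank_eq_zero, LinearMap.range_eq_bot] at h
    exact hN' h
  rw [mk_step ψ hψ α hα n (mk_inv ψ hψ α hα _) (mk_inv ψ hψ α hα _) f hn r hr hN hN' V₁ f₁ hn₁ hD₁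
    (mkK ψ f₂) (mkK ψ f₃)
    (fun h => ⟨V₂, _, _, inferInstance, f₂, hn₂ h, hD₂ h, rfl⟩)
    (fun h => ⟨V₃, _, _, inferInstance, f₃, hn₃ (by omega), hD₃ (by omega), rfl⟩), hm]
  have e2 : (Nat.card F : ℂ) ^ (2 * n - 3) * (if 2 ≤ r then (Nat.card F : ℂ) ^ m * mkK ψ f₂ else 0)
      = (Nat.card F : ℂ) ^ (2 * n + m - 3) * (if 2 ≤ r then mkK ψ f₂ else 0) := by
    split_ifs with h
    · have := hn₂ h
      have e : 2 * n + m - 3 = (2 * n - 3) + m := by omega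
      rw [e, pow_add]; ring
    · simp
  have e3 : (Nat.card F : ℂ) ^ (2 * n - 3) * (((Nat.card F : ℂ) ^ m - Nat.card F) * mkK ψ f₃)
      = ((Nat.card F : ℂ) ^ (m - 1) - 1) * (Nat.card F : ℂ) ^ (2 * n - 2)
        * (if 2 ≤ m then mkK ψ f₃ else 0) := by
    split_ifs with h
    · have := hn₃ h
      have e : 2 * n - 2 = (2 * n - 3) + 1 := by omega
      have e' : m = (m - 1) + 1 := by omega
      rw [e]
      conv_lhs => rw [e']
      rw [pow_succ, pow_succ]; ring
    · have : m = 1 := by omega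
      simp [this]
  rw [mul_sub, e2, e3]
  ring

end MKCore

theorem mk_matK {F : Type} [Field F] [Fintype F] [DecidableEq F] (ψ : F → ℂ) (χ : AddChar F ℂ)
    (h : ∀ x, χ x = ψ x) {m : ℕ} (b : Matrix (Fin m) (Fin m) F) :
    matKloosterman F ψ b = mkK χ (Matrix.toLin' b) := by
  unfold matKloosterman mkK
  haveI : Finite ((Fin m → F) ≃ₗ[F] (Fin m → F)) := mk_finite_equiv
  letI : Fintype ((Fin m → F) ≃ₗ[F] (Fin m → F)) := Fintype.ofFinite _
  refine Fintype.sum_equiv ((Matrix.GeneralLinearGroup.toLin (n := Fin m) (R := F)).trans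
    (LinearMap.GeneralLinearGroup.generalLinearEquiv F (Fin m → F))).toEquiv _ _ ?_
  intro x
  unfold mkE
  rw [h, Matrix.trace_add]
  congr 2
  · rw [← Matrix.trace_toLin'_eq, Matrix.toLin'_mul]
    rfl
  · rw [← Matrix.trace_toLin'_eq]
    rfl

theorem mk_kdim {F : Type} [Field F] [Finite F] {m : ℕ} (b : Matrix (Fin m) (Fin m) F) (α : F)
    (j : ℕ) : kdim F b α j = mkD α (Matrix.toLin' b) j := by
  unfold kdim mkD mkN
  rw [← Matrix.toLin'_apply', Matrix.toLin'_pow, map_sub, map_smul, Matrix.toLin'_one]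

/-- the recursion
`K(a) = q^{n−1}·Kl(α)·K(a′) − q^{2n+μ_r−3}·K(a″) + (q^{μ_r−1} − 1)·q^{2n−2}·K(a‴)`
for matrices with unique nonzero eigenvalue `α` and filtration types `μ, μ′, μ″, μ‴`
(the `a″` term omitted when `r = 1`, the `a‴` term omitted when `μ_r = 1`). -/
theorem matrix_kloosterman_recursion
    (F : Type) [Field F] [Fintype F] [DecidableEq F]
    (ψ : F → ℂ) (hψadd : ∀ x y : F, ψ (x + y) = ψ x * ψ y)
    (hψnt : ψ ≠ fun _ => 1)
    (α : F) (hα : α ≠ 0)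
    (n r : ℕ) (hn : 1 ≤ n) (hr : 1 ≤ r)
    (μ : ℕ → ℕ)
    (hμmono : ∀ i j : ℕ, 1 ≤ i → i ≤ j → j ≤ r → μ j ≤ μ i) (hμr : 1 ≤ μ r)
    (a : Matrix (Fin n) (Fin n) F)
    (a' : Matrix (Fin (n - 1)) (Fin (n - 1)) F)
    (a'' : Matrix (Fin (n - 2)) (Fin (n - 2)) F)
    (a''' : Matrix (Fin (n - 2)) (Fin (n - 2)) F)
    -- `a` has unique eigenvalue `α` and filtration type `μ = [μ_1 ≥ … ≥ μ_r]`
    (ha : (∀ j ∈ Finset.Icc 1 r, kdim F a α j = kdim F a α (j - 1) + μ j)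
      ∧ kdim F a α r = n)
    -- `a′` has unique eigenvalue `α` and filtration type `μ′` (zero parts dropped)
    (ha' : (∀ j ∈ Finset.Icc 1 r,
        kdim F a' α j = kdim F a' α (j - 1) + Function.update μ r (μ r - 1) j)
      ∧ kdim F a' α r = n - 1)
    -- when `r ≥ 2`, `a″` has unique eigenvalue `α` and filtration type `μ″`
    (ha'' : 2 ≤ r → ((∀ j ∈ Finset.Icc 1 r,
        kdim F a'' α j = kdim F a'' α (j - 1)
          + (if j = r then μ r - 1 else if j = r - 1 then μ (r - 1) - 1 else μ j))
      ∧ kdim F a'' α r = n - 2))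
    -- when `μ_r ≥ 2`, `a‴` has unique eigenvalue `α` and filtration type `μ‴`
    (ha''' : 2 ≤ μ r → ((∀ j ∈ Finset.Icc 1 r,
        kdim F a''' α j = kdim F a''' α (j - 1) + Function.update μ r (μ r - 2) j)
      ∧ kdim F a''' α r = n - 2)) :
    matKloosterman F ψ a
      = (Fintype.card F : ℂ) ^ (n - 1)
            * (∑ x : Fˣ, ψ (α * (x : F) + ((x⁻¹ : Fˣ) : F)))
            * matKloosterman F ψ a'
        - (Fintype.card F : ℂ) ^ (2 * n + μ r - 3)
            * (if 2 ≤ r then matKloosterman F ψ a'' else 0)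
        + ((Fintype.card F : ℂ) ^ (μ r - 1) - 1) * (Fintype.card F : ℂ) ^ (2 * n - 2)
            * (if 2 ≤ μ r then matKloosterman F ψ a''' else 0) := by
  have h00 : ψ 0 = ψ 0 * ψ 0 := by simpa using hψadd 0 0
  by_cases h0 : ψ 0 = 0
  · have hz : ∀ x, ψ x = 0 := fun x => by
      have := hψadd x 0
      rwa [h0, mul_zero, add_zero] at this
    simp [matKloosterman, hz]
  have h1 : ψ 0 = 1 := by
    have := mul_left_cancel₀ h0 (show ψ 0 * 1 = ψ 0 * ψ 0 by rw [mul_one]; exact h00)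
    exact this.symm
  let χ : AddChar F ℂ := { toFun := ψ, map_zero_eq_one' := h1, map_add_eq_mul' := hψadd }
  have hχ : ∀ x, χ x = ψ x := fun x => rfl
  have hχ1 : χ ≠ 1 := by
    intro h
    apply hψnt
    funext x
    rw [← hχ x, h]
    rfl
  obtain ⟨ha1, ha2⟩ := ha
  obtain ⟨hb1, hb2⟩ := ha'
  simp only [mk_kdim, Finset.mem_Icc] at ha1 ha2 hb1 hb2 ha'' ha'''
  have fr : ∀ k : ℕ, finrank F (Fin k → F) = k := fun k => Module.finrank_fin_fun F
  have hge : ∀ (k : ℕ) (b : Matrix (Fin k) (Fin k) F), mkD α (Matrix.toLin' b) r = k →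
      ∀ j, r ≤ j → mkD α (Matrix.toLin' b) j = k := by
    intro k b hb j hj
    have := mkD_ge α (Matrix.toLin' b) r j hj (by rw [hb, fr])
    rw [this, fr]
  have hr1 := ha1 r ⟨hr, le_rfl⟩
  have hrange := mkD_range α (Matrix.toLin' a) (r - 1)
  rw [fr] at hrange
  -- agreement of the filtration dimensions below a given level
  have hagree : ∀ (k s : ℕ) (b : Matrix (Fin k) (Fin k) F) (ν : ℕ → ℕ), s ≤ r →
      (∀ j, 1 ≤ j ∧ j ≤ r → mkD α (Matrix.toLin' b) j = mkD α (Matrix.toLin' b) (j - 1) + ν j) →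
      (∀ j, j < s → ν j = μ j) →
      ∀ j, j < s → mkD α (Matrix.toLin' b) j = mkD α (Matrix.toLin' a) j := by
    intro k s b ν hs hb hν j
    induction j with
    | zero => intro _; rw [mkD_zero, mkD_zero]
    | succ j ih =>
      intro hj
      rw [hb (j + 1) (by omega), ha1 (j + 1) (by omega), hν _ hj]
      simp only [Nat.add_sub_cancel]
      rw [ih (by omega)]
  have hm2 : 2 ≤ r → 2 ≤ n := by
    intro h
    have e1 := ha1 (r - 1) (by omega)
    have e2 := hμmono (r - 1) r (by omega) (by omega) le_rfl
    omega
  have key := mk_final χ hχ1 α hα n (Matrix.toLin' a) (fr n) r hr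
    ((mkD_eq_iff _ _ _).1 (by rw [ha2, fr]))
    (fun h => by
      have := (mkD_eq_iff _ _ _).2 h
      rw [fr] at this
      omega)
    (Fin (n - 1) → F) (Matrix.toLin' a') (by rw [fr]; omega)
    (by
      intro j
      split_ifs with hj
      · rw [hagree _ r a' _ le_rfl hb1 (fun j hj => Function.update_of_ne (by omega) _ _) j hj]
      · rw [hge _ a' hb2 j (by omega), hge _ a ha2 j (by omega)]
        omega)
    (Fin (n - 2) → F) (Matrix.toLin' a'') (fun h => by rw [fr]; have := hm2 h; omega)
    (by
      intro h j
      have h2 := hm2 h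
      obtain ⟨hc1, hc2⟩ := ha'' h
      have hlow := hagree _ (r - 1) a'' _ (by omega) hc1
        (fun j hj => by rw [if_neg (by omega), if_neg (by omega)])
      by_cases hj : j + 1 < r
      · rw [if_pos (by omega), if_pos hj, hlow j (by omega)]
      · rw [if_neg hj]
        by_cases hj' : j < r
        · have hj1 : j = r - 1 := by omega
          have e1 := ha1 (r - 1) (by omega)
          have e2 := hμmono (r - 1) r (by omega) (by omega) le_rfl
          have e3 := hc1 (r - 1) (by omega)
          rw [if_neg (by omega), if_pos rfl, hlow (r - 1 - 1) (by omega)] at e3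
          rw [if_pos hj', hj1]
          omega
        · rw [if_neg hj', hge _ a'' hc2 j (by omega), hge _ a ha2 j (by omega)]
          omega)
    (μ r) (by omega)
    (Fin (n - 2) → F) (Matrix.toLin' a''') (fun h => by rw [fr]; omega)
    (by
      intro h j
      obtain ⟨hc1, hc2⟩ := ha''' h
      split_ifs with hj
      · rw [hagree _ r a''' _ le_rfl hc1 (fun j hj => Function.update_of_ne (by omega) _ _) j hj]
      · rw [hge _ a''' hc2 j (by omega), hge _ a ha2 j (by omega)]
        omega)
  rw [mk_matK ψ χ hχ a, mk_matK ψ χ hχ a', mk_matK ψ χ hχ a'', mk_matK ψ χ hχ a''']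
  rw [Nat.card_eq_fintype_card] at key
  convert key
  exact (hχ _).symm
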